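/- Let B be a commutative ring and B' a commutative B-algebra that is faithfully flat as a B-module. Then the sequence B((t)) → B'((t)) ⇉ (B' ⊗_B B')((t)) is exact: the induced map B((t)) → B'((t)) is injective, and an element g ∈ B'((t)) whose two images in (B' ⊗_B B')((t)) (under the maps induced by b' ↦ b' ⊗ 1 and b' ↦ 1 ⊗ b') coincide is the image of a (unique) element f ∈ B((t)). In particular, for every affine scheme (equivalently, every commutative A-algebra R with loop functor R ↦ Hom(R, −((t)))), the loop functor B ↦ Hom_{ring}(R, B((t))) satisfies the sheaf condition for the faithfully flat cover B → B'. -/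

import Mathlib

open TensorProduct

/-- The map `B((t)) → B'((t))` on Laurent series (localizations of power series rings away
from `t`) induced by a ring homomorphism `B → B'`. -/
noncomputable def seriesLocMap {B B' : Type*} [CommRing B] [CommRing B'] (φ : B →+* B') :
    Localization.Away (PowerSeries.X : PowerSeries B) →+*
      Localization.Away (PowerSeries.X : PowerSeries B') :=
  Localization.awayLift ((algebraMap (PowerSeries B') _).comp (PowerSeries.map φ)) _
    (by
      rw [RingHom.comp_apply, PowerSeries.map_X]
      exact IsLocalization.Away.algebraMap_isUnit _)

lemma seriesLocMap_algebraMap {B B' : Type*} [CommRing B] [CommRing B'] (φ : B →+* B')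
    (a : PowerSeries B) :
    seriesLocMap φ (algebraMap _ _ a) = algebraMap _ _ (PowerSeries.map φ a) := by
  rw [seriesLocMap, IsLocalization.Away.lift_eq, RingHom.comp_apply]

lemma algebraMap_away_X_injective (B : Type*) [CommRing B] :
    Function.Injective (algebraMap (PowerSeries B)
      (Localization.Away (PowerSeries.X : PowerSeries B))) := by
  intro a b h
  obtain ⟨n, hn⟩ := IsLocalization.Away.exists_of_eq (PowerSeries.X : PowerSeries B) h
  exact PowerSeries.X_pow_mul_cancel hn

lemma seriesLocMap_algebraMap_X_pow {B B' : Type*} [CommRing B] [CommRing B'] (φ : B →+* B')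
    (n : ℕ) :
    seriesLocMap φ (algebraMap (PowerSeries B) _ PowerSeries.X ^ n) =
      algebraMap (PowerSeries B') _ PowerSeries.X ^ n := by
  rw [map_pow, seriesLocMap_algebraMap, PowerSeries.map_X]

lemma seriesLocMap_injective {B B' : Type*} [CommRing B] [CommRing B'] {φ : B →+* B'}
    (hφ : Function.Injective φ) : Function.Injective (seriesLocMap φ) := by
  rw [injective_iff_map_eq_zero]
  intro z hz
  obtain ⟨n, a, ha⟩ := IsLocalization.Away.surj (PowerSeries.X : PowerSeries B) z
  have h := congr(seriesLocMap φ $ha)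
  rw [map_mul, hz, zero_mul, seriesLocMap_algebraMap, eq_comm,
    map_eq_zero_iff _ (algebraMap_away_X_injective B'),
    map_eq_zero_iff _ (PowerSeries.map_injective φ hφ)] at h
  rw [h, map_zero] at ha
  exact ((IsLocalization.Away.algebraMap_pow_isUnit _ n).mul_left_eq_zero).mp ha

/-- If every element of `B'` equalized by `i` and `j` comes from `B`, then the same holds for
Laurent series. -/
lemma exists_seriesLocMap_eq {B B' C : Type*} [CommRing B] [CommRing B'] [CommRing C]
    {φ : B →+* B'} {i j : B' →+* C} (h : ∀ x, i x = j x → ∃ y, φ y = x)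
    {g : Localization.Away (PowerSeries.X : PowerSeries B')}
    (hg : seriesLocMap i g = seriesLocMap j g) : ∃ f, seriesLocMap φ f = g := by
  obtain ⟨n, a, ha⟩ := IsLocalization.Away.surj (PowerSeries.X : PowerSeries B') g
  have hij : PowerSeries.map i a = PowerSeries.map j a := by
    apply algebraMap_away_X_injective
    rw [← seriesLocMap_algebraMap, ← seriesLocMap_algebraMap, ← ha, map_mul, map_mul, hg,
      seriesLocMap_algebraMap_X_pow, seriesLocMap_algebraMap_X_pow]
  have hcoeff (k : ℕ) : ∃ y, φ y = PowerSeries.coeff k a :=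
    h _ (by simpa using congr(PowerSeries.coeff k $hij))
  choose b hb using hcoeff
  have hba : PowerSeries.map φ (PowerSeries.mk b) = a := by
    ext k
    simp [hb]
  obtain ⟨f, hf⟩ := (IsLocalization.Away.algebraMap_pow_isUnit (PowerSeries.X : PowerSeries B)
    (S := Localization.Away (PowerSeries.X : PowerSeries B)) n).dvd
      (a := algebraMap _ _ (PowerSeries.mk b))
  refine ⟨f, (IsLocalization.Away.algebraMap_pow_isUnit (PowerSeries.X : PowerSeries B')
    n).mul_right_cancel ?_⟩
  rw [ha, ← hba, ← seriesLocMap_algebraMap, hf, map_mul, seriesLocMap_algebraMap_X_pow, mul_comm]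

lemma RingHom.existsUnique_comp_eq {R S T : Type*} [CommRing R] [CommRing S] [CommRing T]
    {f : S →+* T} (hf : Function.Injective f) {φ : R →+* T} (h : ∀ r, ∃ s, f s = φ r) :
    ∃! ψ : R →+* S, f.comp ψ = φ := by
  choose ψ hψ using h
  refine ⟨{
    toFun := ψ
    map_one' := hf (by simp [hψ])
    map_mul' := fun x y ↦ hf (by simp [hψ])
    map_zero' := hf (by simp [hψ])
    map_add' := fun x y ↦ hf (by simp [hψ]) }, RingHom.ext hψ, fun ψ' h' ↦ ?_⟩
  ext r
  exact hf ((RingHom.congr_fun h' r).trans (hψ r).symm)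

/-- For a faithfully flat algebra `B → B'`, the sequence
`B((t)) → B'((t)) ⇉ (B' ⊗_B B')((t))` is exact: the map `B((t)) → B'((t))` is injective,
any `g ∈ B'((t))` equalizing the two maps to `(B' ⊗_B B')((t))` descends to a unique
`f ∈ B((t))`; in particular, the loop functor `B ↦ Hom(R, B((t)))` of any affine scheme
(commutative ring `R`) satisfies the sheaf condition for the cover `B → B'`. -/
theorem laurentSeries_descent_exact.{u} (B B' : Type*) [CommRing B] [CommRing B'] [Algebra B B']
    [Module.FaithfullyFlat B B'] :
    Function.Injective (seriesLocMap (algebraMap B B')) ∧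
    (∀ g : Localization.Away (PowerSeries.X : PowerSeries B'),
      seriesLocMap (Algebra.TensorProduct.includeLeftRingHom : B' →+* B' ⊗[B] B') g =
        seriesLocMap
          ((Algebra.TensorProduct.includeRight : B' →ₐ[B] B' ⊗[B] B') : B' →+* B' ⊗[B] B') g →
      ∃! f : Localization.Away (PowerSeries.X : PowerSeries B),
        seriesLocMap (algebraMap B B') f = g) ∧
    (∀ (R : Type u) [CommRing R]
      (φ : R →+* Localization.Away (PowerSeries.X : PowerSeries B')),
      (seriesLocMap (Algebra.TensorProduct.includeLeftRingHom : B' →+* B' ⊗[B] B')).comp φ =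
        (seriesLocMap
          ((Algebra.TensorProduct.includeRight : B' →ₐ[B] B' ⊗[B] B') : B' →+* B' ⊗[B] B')).comp
          φ →
      ∃! ψ : R →+* Localization.Away (PowerSeries.X : PowerSeries B),
        (seriesLocMap (algebraMap B B')).comp ψ = φ) := by
  have hinj : Function.Injective (seriesLocMap (algebraMap B B')) :=
    seriesLocMap_injective (FaithfulSMul.algebraMap_injective B B')
  have hex (x : B') (hx : (Algebra.TensorProduct.includeLeftRingHom : B' →+* B' ⊗[B] B') x =
      ((Algebra.TensorProduct.includeRight : B' →ₐ[B] B' ⊗[B] B') : B' →+* B' ⊗[B] B') x) :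
      ∃ y, algebraMap B B' y = x :=
    (Algebra.IsEffective.of_faithfullyFlat B B' x).mp (sub_eq_zero.mpr hx)
  refine ⟨hinj, fun g hg ↦ ?_, fun R _ φ hφ ↦ ?_⟩
  · obtain ⟨f, hf⟩ := exists_seriesLocMap_eq hex hg
    exact ⟨f, hf, fun f' hf' ↦ hinj (hf'.trans hf.symm)⟩
  · exact RingHom.existsUnique_comp_eq hinj fun r ↦
      exists_seriesLocMap_eq hex (RingHom.congr_fun hφ r)
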